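/- arXiv:1709.08185 — 2 statements merged into one kernel-verified Lean document; each statement's English description precedes it below -/
import Mathlib

section
/- Let n ≥ 1, let α ∈ L^∞(ℝ^n) be log-Hölder continuous at the origin and at infinity (with value α_∞ at infinity), let q ∈ P_b(ℝ^n), let 0 < p < ∞ and 0 ≤ λ < ∞, and let ω be a weight on ℝ^n. Then there exists a constant C > 0 such that for every measurable f and every integer j ≤ 0: ‖f χ_j‖_{L^{q(·)}_ω} ≤ C·2^{j(λ − α(0))}·‖f‖_{MK̇^{α(·),λ}_{p,q(·),ω}}, and for every integer j ≥ 0: ‖f χ_j‖_{L^{q(·)}_ω} ≤ C·2^{j(λ − α_∞)}·‖f‖_{MK̇^{α(·),λ}_{p,q(·),ω}}. -/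
open MeasureTheory ENNReal

noncomputable section

abbrev Euc (n : ℕ) := EuclideanSpace ℝ (Fin n)

/-- Frobenius norm of a square matrix. -/
def frobNorm {n : ℕ} (A : Matrix (Fin n) (Fin n) ℝ) : ℝ :=
  Real.sqrt (∑ i, ∑ j, (A i j) ^ 2)

/-- Action of a matrix on a point of Euclidean space. -/
def matVec {n : ℕ} (A : Matrix (Fin n) (Fin n) ℝ) (x : Euc n) : Euc n :=
  (WithLp.equiv 2 (Fin n → ℝ)).symm (A.mulVec ((WithLp.equiv 2 (Fin n → ℝ)) x))

/-- The multilinear Hausdorff operator. -/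
def hausdorffOp {n : ℕ} (m : ℕ) (Φ : Euc n → ℝ)
    (A : Fin m → Euc n → Matrix (Fin n) (Fin n) ℝ)
    (f : Fin m → Euc n → ℝ) (x : Euc n) : ℝ :=
  ∫ t : Euc n, (Φ t / ‖t‖ ^ n) * ∏ i, f i (matVec (A i t) x)

/-- The variable exponent Lebesgue norm, exponent valued in `ℝ≥0∞`. -/
def vNorm {n : ℕ} (p : Euc n → ℝ≥0∞) (f : Euc n → ℝ) : ℝ≥0∞ :=
  sInf {η : ℝ≥0∞ | η ≠ 0 ∧
    (∫⁻ x in {x | p x ≠ ∞}, (ENNReal.ofReal |f x| / η) ^ (p x).toReal ∂volume)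
      + essSup (fun x => ENNReal.ofReal |f x| / η) (volume.restrict {x | p x = ∞}) ≤ 1}

/-- The weighted variable exponent Lebesgue norm `‖f ω‖_{L^{p(·)}}`. -/
def wnorm {n : ℕ} (p : Euc n → ℝ≥0∞) (ω f : Euc n → ℝ) : ℝ≥0∞ :=
  vNorm p (fun x => f x * ω x)

def ofExp {n : ℕ} (q : Euc n → ℝ) : Euc n → ℝ≥0∞ := fun x => ENNReal.ofReal (q x)

def expMinus {n : ℕ} (q : Euc n → ℝ) : ℝ := essInf q volume
def expPlus {n : ℕ} (q : Euc n → ℝ) : ℝ := essSup q volume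

/-- The class `P_b`: measurable exponents `q : ℝⁿ → [1,∞)` with `1 < q₋ ≤ q₊ < ∞`. -/
def IsPb {n : ℕ} (q : Euc n → ℝ) : Prop :=
  Measurable q ∧ (∀ x, 1 ≤ q x) ∧ 1 < expMinus q ∧ ∃ M : ℝ, ∀ᵐ x : Euc n, q x ≤ M

/-- The constant `c_{A,q,γ}(t)` (with `qp = q₊`, `qm = q₋`). -/
def cfun {n : ℕ} (A : Matrix (Fin n) (Fin n) ℝ) (qp qm γ : ℝ) : ℝ :=
  max (frobNorm A ^ (-γ)) (frobNorm A⁻¹ ^ γ) *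
    max (|(A⁻¹).det| ^ (1 / qp)) (|(A⁻¹).det| ^ (1 / qm))

/-- The exponent `r` given by `1/r(x) = 1/q(A⁻¹x) − 1/(ζ q(x))` (valued in `ℝ≥0∞`,
with `r(x) = ∞` where the two reciprocals coincide). -/
def rExp {n : ℕ} (q : Euc n → ℝ) (ζ : ℝ) (A : Matrix (Fin n) (Fin n) ℝ) : Euc n → ℝ≥0∞ :=
  fun x => (ENNReal.ofReal (1 / q (matVec A⁻¹ x) - 1 / (ζ * q x)))⁻¹

/-- The dyadic annulus `C_k`. -/
def annulus {n : ℕ} (k : ℤ) : Set (Euc n) :=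
  {x | (2:ℝ) ^ (k - 1) < ‖x‖ ∧ ‖x‖ ≤ (2:ℝ) ^ k}

/-- `‖2^{kα(·)} f χ_k‖_{L^{q(·)}_ω}`. -/
def herzTerm {n : ℕ} (qe : Euc n → ℝ≥0∞) (ω α : Euc n → ℝ) (f : Euc n → ℝ) (k : ℤ) : ℝ≥0∞ :=
  wnorm qe ω ((annulus k).indicator (fun x => (2:ℝ) ^ ((k : ℝ) * α x) * f x))

/-- Variable exponent weighted Herz norm. -/
def herzNormV {n : ℕ} (α : Euc n → ℝ) (p : ℝ) (qe : Euc n → ℝ≥0∞) (ω : Euc n → ℝ)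
    (f : Euc n → ℝ) : ℝ≥0∞ :=
  (∑' k : ℤ, herzTerm qe ω α f k ^ p) ^ (1 / p)

/-- Variable exponent weighted Morrey–Herz norm. -/
def morreyHerzNormV {n : ℕ} (α : Euc n → ℝ) (lam p : ℝ) (qe : Euc n → ℝ≥0∞) (ω : Euc n → ℝ)
    (f : Euc n → ℝ) : ℝ≥0∞ :=
  ⨆ k₀ : ℤ, ENNReal.ofReal ((2:ℝ) ^ (-(k₀:ℝ) * lam)) *
    (∑' k : {k : ℤ // k ≤ k₀}, herzTerm qe ω α f k ^ p) ^ (1 / p)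

/-- Weighted `L^q(ω)` norm (constant exponent). -/
def wLq {n : ℕ} (q : ℝ) (ω f : Euc n → ℝ) : ℝ≥0∞ :=
  (∫⁻ x, ENNReal.ofReal (|f x| ^ q * ω x)) ^ (1 / q)

/-- Weighted Herz norm (constant exponents). -/
def herzNormC {n : ℕ} (alp p q : ℝ) (ω f : Euc n → ℝ) : ℝ≥0∞ :=
  (∑' k : ℤ, ENNReal.ofReal ((2:ℝ) ^ ((k:ℝ) * alp * p)) *
    wLq q ω ((annulus k).indicator f) ^ p) ^ (1 / p)

/-- Weighted Morrey–Herz norm (constant exponents). -/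
def morreyHerzNormC {n : ℕ} (alp lam p q : ℝ) (ω f : Euc n → ℝ) : ℝ≥0∞ :=
  ⨆ k₀ : ℤ, ENNReal.ofReal ((2:ℝ) ^ (-(k₀:ℝ) * lam)) *
    (∑' k : {k : ℤ // k ≤ k₀}, ENNReal.ofReal ((2:ℝ) ^ (((k:ℤ):ℝ) * alp * p)) *
      wLq q ω ((annulus (k:ℤ)).indicator f) ^ p) ^ (1 / p)

/-- `∫_{B(0,R)} ω`. -/
def wIntBall {n : ℕ} (ω : Euc n → ℝ) (R : ℝ) : ℝ≥0∞ :=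
  ∫⁻ x in Metric.ball (0 : Euc n) R, ENNReal.ofReal (ω x)

/-- Weighted λ-central Morrey norm (constant exponent). -/
def cMorreyNorm {n : ℕ} (q lam : ℝ) (ω f : Euc n → ℝ) : ℝ≥0∞ :=
  ⨆ R : {R : ℝ // 0 < R}, (wIntBall ω R ^ (-(1 + lam * q)) *
    ∫⁻ x in Metric.ball (0 : Euc n) (R : ℝ), ENNReal.ofReal (|f x| ^ q * ω x)) ^ (1 / q)

/-- Two-weight λ-central Morrey norm (constant exponent). -/
def cMorrey2Norm {n : ℕ} (q lam : ℝ) (ω₁ ω₂ f : Euc n → ℝ) : ℝ≥0∞ :=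
  ⨆ R : {R : ℝ // 0 < R}, wIntBall ω₁ R ^ (-(lam + 1 / q)) *
    (∫⁻ x in Metric.ball (0 : Euc n) (R : ℝ), ENNReal.ofReal (|f x * ω₂ x| ^ q)) ^ (1 / q)

/-- Two-weight λ-central Morrey norm with variable exponent. -/
def cMorrey2NormV {n : ℕ} (qe : Euc n → ℝ≥0∞) (qinf lam : ℝ) (ω₁ ω₂ f : Euc n → ℝ) : ℝ≥0∞ :=
  ⨆ R : {R : ℝ // 0 < R}, wIntBall ω₁ R ^ (-(lam + 1 / qinf)) *
    wnorm qe ω₂ ((Metric.ball (0 : Euc n) (R : ℝ)).indicator f)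

/-- log-Hölder continuity at the origin with constant `C₀`. -/
def LogHolder0 {n : ℕ} (α : Euc n → ℝ) (C₀ : ℝ) : Prop :=
  ∀ x : Euc n, |α x - α 0| ≤ C₀ / Real.log (Real.exp 1 + 1 / ‖x‖)

/-- log-Hölder continuity at infinity with constant `C∞` and value `αinf`. -/
def LogHolderInf {n : ℕ} (α : Euc n → ℝ) (Cinf αinf : ℝ) : Prop :=
  ∀ x : Euc n, |α x - αinf| ≤ Cinf / Real.log (Real.exp 1 + ‖x‖)

end

/-- Pointwise domination by a positive multiple passes to the variable exponent norm. -/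
theorem vNorm_le_mul_of_abs_le {n : ℕ} (p : Euc n → ℝ≥0∞) {f g : Euc n → ℝ} {c : ℝ}
    (hc : 0 < c) (h : ∀ x, |f x| ≤ c * |g x|) :
    vNorm p f ≤ ENNReal.ofReal c * vNorm p g := by
  have hc0 : ENNReal.ofReal c ≠ 0 := by simpa using hc
  have hct : ENNReal.ofReal c ≠ ∞ := ENNReal.ofReal_ne_top
  rw [← ENNReal.div_le_iff' hc0 hct]
  refine le_sInf fun η hη => ?_
  rw [ENNReal.div_le_iff' hc0 hct]
  have hpt : ∀ x, ENNReal.ofReal |f x| / (ENNReal.ofReal c * η) ≤ ENNReal.ofReal |g x| / η := by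
    intro x
    calc ENNReal.ofReal |f x| / (ENNReal.ofReal c * η)
        ≤ (ENNReal.ofReal c * ENNReal.ofReal |g x|) / (ENNReal.ofReal c * η) := by
          rw [← ENNReal.ofReal_mul hc.le]
          gcongr
          exact h x
      _ = ENNReal.ofReal |g x| / η := ENNReal.mul_div_mul_left _ _ hc0 hct
  refine sInf_le ⟨mul_ne_zero hc0 hη.1, le_trans ?_ hη.2⟩
  refine add_le_add (lintegral_mono fun x => ?_) (essSup_mono_ae (ae_of_all _ hpt))
  exact ENNReal.rpow_le_rpow (hpt x) ENNReal.toReal_nonneg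

/-- Each block of the Morrey–Herz norm is controlled by the whole norm. -/
theorem herzTerm_le_mul_morreyHerzNormV {n : ℕ} (qe : Euc n → ℝ≥0∞) (ω α f : Euc n → ℝ)
    (lam : ℝ) {p : ℝ} (hp : 0 < p) (j : ℤ) :
    herzTerm qe ω α f j ≤
      ENNReal.ofReal ((2:ℝ) ^ ((j : ℝ) * lam)) * morreyHerzNormV α lam p qe ω f := by
  have hsum : herzTerm qe ω α f j ≤
      (∑' k : {k : ℤ // k ≤ j}, herzTerm qe ω α f k ^ p) ^ (1 / p) := by
    rw [one_div, ENNReal.le_rpow_inv_iff hp]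
    exact ENNReal.le_tsum (f := fun k : {k : ℤ // k ≤ j} => herzTerm qe ω α f k ^ p) ⟨j, le_rfl⟩
  have hsup : ENNReal.ofReal ((2:ℝ) ^ (-(j:ℝ) * lam)) * herzTerm qe ω α f j ≤
      morreyHerzNormV α lam p qe ω f :=
    (mul_le_mul_right hsum _).trans (le_iSup (fun k₀ : ℤ =>
      ENNReal.ofReal ((2:ℝ) ^ (-(k₀:ℝ) * lam)) *
        (∑' k : {k : ℤ // k ≤ k₀}, herzTerm qe ω α f k ^ p) ^ (1 / p)) j)
  calc herzTerm qe ω α f j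
      = ENNReal.ofReal ((2:ℝ) ^ ((j : ℝ) * lam)) *
          (ENNReal.ofReal ((2:ℝ) ^ (-(j:ℝ) * lam)) * herzTerm qe ω α f j) := by
        rw [← mul_assoc, ← ENNReal.ofReal_mul (by positivity), ← Real.rpow_add two_pos]
        simp
    _ ≤ _ := by gcongr

/-- Block estimate when `α` is within `K / |j|` of the constant `a` on the annulus `C_j`. -/
theorem wnorm_indicator_annulus_le {n : ℕ} (qe : Euc n → ℝ≥0∞) (ω α f : Euc n → ℝ)
    (lam : ℝ) {p : ℝ} (hp : 0 < p) {K a : ℝ} {j : ℤ}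
    (h : ∀ x ∈ annulus (n := n) j, |(j : ℝ)| * |α x - a| ≤ K) :
    wnorm qe ω ((annulus j).indicator f) ≤
      ENNReal.ofReal ((2:ℝ) ^ K * (2:ℝ) ^ ((j : ℝ) * (lam - a))) *
        morreyHerzNormV α lam p qe ω f := by
  have hw : wnorm qe ω ((annulus j).indicator f) ≤
      ENNReal.ofReal ((2:ℝ) ^ (K - j * a)) * herzTerm qe ω α f j := by
    refine vNorm_le_mul_of_abs_le qe (by positivity) fun x => ?_
    by_cases hx : x ∈ annulus j
    · have hK := (abs_le.1 ((abs_mul (j : ℝ) (α x - a)).trans_le (h x hx))).1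
      have h1 : (1:ℝ) ≤ (2:ℝ) ^ (K - j * a) * (2:ℝ) ^ ((j : ℝ) * α x) := by
        rw [← Real.rpow_add two_pos]
        exact Real.one_le_rpow one_le_two (by linarith)
      have h2 : (0:ℝ) ≤ (2:ℝ) ^ ((j : ℝ) * α x) := by positivity
      simp only [Set.indicator_of_mem hx, abs_mul, abs_of_nonneg h2]
      calc |f x| * |ω x| ≤ ((2:ℝ) ^ (K - j * a) * (2:ℝ) ^ ((j : ℝ) * α x)) * (|f x| * |ω x|) :=
            le_mul_of_one_le_left (by positivity) h1
        _ = _ := by ring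
    · simp [Set.indicator_of_notMem hx]
  refine hw.trans ((mul_le_mul_right
    (herzTerm_le_mul_morreyHerzNormV qe ω α f lam hp j) _).trans_eq ?_)
  rw [← mul_assoc, ← ENNReal.ofReal_mul (by positivity), ← Real.rpow_add two_pos,
    ← Real.rpow_add two_pos]
  congr 3
  ring

theorem mul_le_of_le_div_of_mul_le {t d C L : ℝ} (ht : 0 ≤ t) (hL : 0 < L) (hd : d ≤ C / L)
    (htL : t * Real.log 2 ≤ 2 * L) : t * d ≤ 2 * |C| / Real.log 2 := by
  have hlog : 0 < Real.log 2 := Real.log_pos one_lt_two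
  have htL' : t / L ≤ 2 / Real.log 2 := by rwa [div_le_div_iff₀ hL hlog]
  calc t * d ≤ t * (|C| / L) := by
        gcongr
        exact hd.trans (by gcongr; exact le_abs_self C)
    _ = |C| * (t / L) := by ring
    _ ≤ |C| * (2 / Real.log 2) := by gcongr
    _ = 2 * |C| / Real.log 2 := by ring

theorem LogHolder0.abs_mul_abs_sub_le {n : ℕ} {α : Euc n → ℝ} {C : ℝ} (h : LogHolder0 α C)
    {j : ℤ} (hj : j ≤ 0) {x : Euc n} (hx : x ∈ annulus j) :
    |(j : ℝ)| * |α x - α 0| ≤ 2 * |C| / Real.log 2 := by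
  have hx0 : 0 < ‖x‖ := lt_trans (by positivity) hx.1
  have he : 1 < Real.exp 1 := Real.one_lt_exp_iff.2 one_pos
  have hinv : (0:ℝ) < 1 / ‖x‖ := by positivity
  have hL : 0 < Real.log (Real.exp 1 + 1 / ‖x‖) := Real.log_pos (by linarith)
  refine mul_le_of_le_div_of_mul_le (abs_nonneg _) hL (h x) ?_
  have hle : (2:ℝ) ^ (-j) ≤ Real.exp 1 + 1 / ‖x‖ := by
    have := one_div_le_one_div_of_le hx0 hx.2
    rw [zpow_neg, ← one_div]
    linarith
  have hlog := Real.log_le_log (by positivity) hle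
  rw [Real.log_zpow] at hlog
  rw [abs_of_nonpos (by exact_mod_cast hj)]
  push_cast at hlog
  linarith

theorem LogHolderInf.abs_mul_abs_sub_le {n : ℕ} {α : Euc n → ℝ} {C a : ℝ}
    (h : LogHolderInf α C a) {j : ℤ} (hj : 0 ≤ j) {x : Euc n} (hx : x ∈ annulus j) :
    |(j : ℝ)| * |α x - a| ≤ 2 * |C| / Real.log 2 := by
  have hx0 : 0 < ‖x‖ := lt_trans (by positivity) hx.1
  have he : 2 ≤ Real.exp 1 := by linarith [Real.add_one_le_exp (1:ℝ)]
  have hL : 0 < Real.log (Real.exp 1 + ‖x‖) := Real.log_pos (by linarith)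
  refine mul_le_of_le_div_of_mul_le (abs_nonneg _) hL (h x) ?_
  have hle : (2:ℝ) ^ j ≤ (Real.exp 1 + ‖x‖) ^ 2 := by
    have h1 := hx.1
    rw [zpow_sub_one₀ two_ne_zero] at h1
    nlinarith
  have hlog := Real.log_le_log (by positivity) hle
  rw [Real.log_zpow, Real.log_pow] at hlog
  rw [abs_of_nonneg (by exact_mod_cast hj)]
  exact_mod_cast hlog

/-- Lemma 2.1: block estimates from the variable exponent weighted
Morrey–Herz norm. -/
theorem stmt14
    {n : ℕ} (hn : 1 ≤ n)
    (α : Euc n → ℝ) (hαbd : ∃ M : ℝ, ∀ x, |α x| ≤ M)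
    (C0 Cinf αinf : ℝ)
    (hα0 : LogHolder0 α C0) (hαinf : LogHolderInf α Cinf αinf)
    (q : Euc n → ℝ) (hq : IsPb q)
    (p : ℝ) (hp : 0 < p) (lam : ℝ) (hlam : 0 ≤ lam)
    (ω : Euc n → ℝ) (hω : ∀ x, 0 ≤ ω x) :
    ∃ C : ℝ, 0 < C ∧ ∀ f : Euc n → ℝ,
      (∀ j : ℤ, j ≤ 0 →
        wnorm (ofExp q) ω ((annulus j).indicator f) ≤
          ENNReal.ofReal (C * (2:ℝ) ^ ((j : ℝ) * (lam - α 0))) *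
            morreyHerzNormV α lam p (ofExp q) ω f) ∧
      (∀ j : ℤ, 0 ≤ j →
        wnorm (ofExp q) ω ((annulus j).indicator f) ≤
          ENNReal.ofReal (C * (2:ℝ) ^ ((j : ℝ) * (lam - αinf))) *
            morreyHerzNormV α lam p (ofExp q) ω f) := by
  have hlog : 0 < Real.log 2 := Real.log_pos one_lt_two
  have hC0 : 0 ≤ 2 * |C0| / Real.log 2 := by positivity
  have hCinf : 0 ≤ 2 * |Cinf| / Real.log 2 := by positivity
  refine ⟨(2:ℝ) ^ (2 * |C0| / Real.log 2 + 2 * |Cinf| / Real.log 2), by positivity,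
    fun f => ⟨fun j hj => ?_, fun j hj => ?_⟩⟩
  · exact wnorm_indicator_annulus_le _ ω α f lam hp fun x hx =>
      (hα0.abs_mul_abs_sub_le hj hx).trans (by linarith)
  · exact wnorm_indicator_annulus_le _ ω α f lam hp fun x hx =>
      (hαinf.abs_mul_abs_sub_le hj hx).trans (by linarith)
end

section
/- Let n ≥ 1, 1 ≤ q < ∞, γ > −n and −1/q < λ < 0. Let ω(x) = |x|^γ and f(x) = |x|^{(n+γ)λ} on ℝ^n. Then ‖f‖_{Ḃ^{q,λ}(ω)} = ((n+γ)/|S^{n−1}|)^{λ}·(1 + qλ)^{−1/q}, where |S^{n−1}| is the surface measure of the unit sphere in ℝ^n; in particular f belongs to the weighted central Morrey space Ḃ^{q,λ}(ω). -/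
open MeasureTheory ENNReal

/-- A power of the norm with exponent `s > -n` integrated over a centred ball of `ℝⁿ`. -/
theorem setLIntegral_ball_norm_rpow {n : ℕ} (hn : 1 ≤ n) {s R : ℝ} (hs : -(n : ℝ) < s)
    (hR : 0 < R) :
    ∫⁻ x in Metric.ball (0 : Euc n) R, ENNReal.ofReal (‖x‖ ^ s) =
      ENNReal.ofReal ((n : ℝ) * (volume (Metric.ball (0 : Euc n) 1)).toReal *
        (R ^ ((n : ℝ) + s) / ((n : ℝ) + s))) := by
  have : Nonempty (Fin n) := ⟨⟨0, hn⟩⟩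
  have hradial : ∀ y : ℝ, 0 < y → y ^ (n - 1) • y ^ s = y ^ ((n : ℝ) + s - 1) := by
    intro y hy
    rw [smul_eq_mul, ← Real.rpow_natCast, ← Real.rpow_add hy]
    congr 1
    push_cast [hn]
    ring
  have hint : IntegrableOn (fun x : Euc n => ‖x‖ ^ s) (Metric.ball 0 R) := by
    rw [integrableOn_fun_norm_addHaar volume (f := fun y : ℝ => y ^ s), finrank_euclideanSpace_fin,
      integrableOn_congr_fun (fun y hy => hradial y hy.1) measurableSet_Ioo,
      intervalIntegral.integrableOn_Ioo_rpow_iff hR]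
    linarith
  rw [← ofReal_integral_eq_lintegral_ofReal hint
    (Filter.Eventually.of_forall fun x => Real.rpow_nonneg (norm_nonneg x) s)]
  congr 1
  have hind : ∫ x in Metric.ball (0 : Euc n) R, ‖x‖ ^ s =
      ∫ x : Euc n, (Set.Iio R).indicator (fun y : ℝ => y ^ s) ‖x‖ := by
    rw [← integral_indicator measurableSet_ball]
    congr 1 with x
    simp [Set.indicator]
  have hline : ∫ y in Set.Ioi (0 : ℝ), y ^ (n - 1) • (Set.Iio R).indicator (fun y => y ^ s) y =
      R ^ ((n : ℝ) + s) / ((n : ℝ) + s) := by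
    calc
      _ = ∫ y in Set.Ioi (0 : ℝ), (Set.Iio R).indicator (fun y => y ^ ((n : ℝ) + s - 1)) y := by
        refine setIntegral_congr_fun measurableSet_Ioi fun y hy => ?_
        by_cases hyR : y < R
        · simpa [hyR] using hradial y hy
        · simp [hyR]
      _ = ∫ y in (0 : ℝ)..R, y ^ ((n : ℝ) + s - 1) := by
        rw [setIntegral_indicator measurableSet_Iio, Set.Ioi_inter_Iio,
          intervalIntegral.integral_of_le hR.le, integral_Ioc_eq_integral_Ioo]
      _ = _ := by
        rw [integral_rpow (Or.inl (by linarith)), sub_add_cancel,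
          Real.zero_rpow (by linarith), sub_zero]
  rw [hind, integral_fun_norm_addHaar, finrank_euclideanSpace_fin, hline, smul_eq_mul,
    nsmul_eq_mul, mul_assoc]
  rfl

/-- exact computation of the weighted λ-central Morrey norm of the power
function `f(x) = |x|^{(n+γ)λ}` with weight `ω(x) = |x|^γ`.  Here the surface measure of the
unit sphere is `|S^{n-1}| = n·vol(B(0,1))`. -/
theorem stmt17
    {n : ℕ} (hn : 1 ≤ n)
    (q : ℝ) (hq : 1 ≤ q) (γ : ℝ) (hγ : -(n : ℝ) < γ)
    (lam : ℝ) (hlamlt : lam < 0) (hlamgt : -(1 / q) < lam) :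
    cMorreyNorm q lam (fun x : Euc n => ‖x‖ ^ γ) (fun x : Euc n => ‖x‖ ^ (((n : ℝ) + γ) * lam))
        = ENNReal.ofReal
          ((((n : ℝ) + γ) / ((n : ℝ) * (volume (Metric.ball (0 : Euc n) 1)).toReal)) ^ lam *
            (1 + q * lam) ^ (-(1 / q))) ∧
      cMorreyNorm q lam (fun x : Euc n => ‖x‖ ^ γ)
        (fun x : Euc n => ‖x‖ ^ (((n : ℝ) + γ) * lam)) < ∞ := by
  rw [and_iff_left_of_imp fun h => h ▸ ofReal_lt_top]
  have : Nonempty (Fin n) := ⟨⟨0, hn⟩⟩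
  have hn0 : (0 : ℝ) < n := by exact_mod_cast hn
  have hq0 : 0 < q := by linarith
  have hb : 0 < 1 + q * lam := by
    have := mul_lt_mul_of_pos_left hlamgt hq0
    rw [mul_neg, mul_one_div_cancel hq0.ne'] at this
    linarith
  have hvol : 0 < (volume (Metric.ball (0 : Euc n) 1)).toReal :=
    toReal_pos (Metric.measure_ball_pos _ _ one_pos).ne' measure_ball_lt_top.ne
  set S : ℝ := (n : ℝ) * (volume (Metric.ball (0 : Euc n) 1)).toReal with hS
  have hSpos : 0 < S := mul_pos hn0 hvol
  obtain ⟨a, ha⟩ : ∃ a : ℝ, a = (n : ℝ) + γ := ⟨_, rfl⟩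
  have hapos : 0 < a := by linarith
  rw [← ha]
  have hexp : (n : ℝ) + (a * lam * q + γ) = a * (1 + q * lam) := by rw [ha]; ring
  have hterm : ∀ R : {R : ℝ // 0 < R},
      (wIntBall (fun x : Euc n => ‖x‖ ^ γ) R ^ (-(1 + lam * q)) *
        ∫⁻ x in Metric.ball (0 : Euc n) (R : ℝ),
          ENNReal.ofReal (|‖x‖ ^ (a * lam)| ^ q * ‖x‖ ^ γ)) ^ (1 / q) =
      ENNReal.ofReal ((a / S) ^ lam * (1 + q * lam) ^ (-(1 / q))) := by
    rintro ⟨R, hR⟩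
    have hweight : wIntBall (fun x : Euc n => ‖x‖ ^ γ) R = ENNReal.ofReal (S * (R ^ a / a)) := by
      rw [wIntBall, setLIntegral_ball_norm_rpow hn hγ hR, ← hS, ← ha]
    have hfun : ∫⁻ x in Metric.ball (0 : Euc n) R,
        ENNReal.ofReal (|‖x‖ ^ (a * lam)| ^ q * ‖x‖ ^ γ) =
        ENNReal.ofReal (S * (R ^ (a * (1 + q * lam)) / (a * (1 + q * lam)))) := by
      rw [← hexp, hS, ← setLIntegral_ball_norm_rpow hn (by nlinarith [mul_pos hapos hb]) hR]
      refine lintegral_congr_ae (ae_restrict_of_ae ?_)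
      filter_upwards [compl_mem_ae_iff.mpr (measure_singleton (0 : Euc n))] with x hx
      have hx0 : 0 < ‖x‖ := norm_pos_iff.mpr hx
      rw [abs_of_nonneg (Real.rpow_nonneg hx0.le _), ← Real.rpow_mul hx0.le, ← Real.rpow_add hx0]
    have hRa : 0 < R ^ a := Real.rpow_pos_of_pos hR a
    have hW : 0 < S * (R ^ a / a) := by positivity
    dsimp only
    rw [hweight, hfun, ofReal_rpow_of_pos hW, ← ofReal_mul (by positivity),
      ofReal_rpow_of_nonneg (by positivity) (by positivity)]
    congr 1
    have hprod : (S * (R ^ a / a)) ^ (-(1 + lam * q)) *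
        (S * (R ^ (a * (1 + q * lam)) / (a * (1 + q * lam)))) =
        (a / S) ^ (lam * q) * (1 + q * lam)⁻¹ := by
      have hW' : S * (R ^ a / a) = (a / S)⁻¹ * R ^ a := by field_simp
      rw [hW', Real.mul_rpow (by positivity) hRa.le, Real.inv_rpow (by positivity),
        ← Real.rpow_neg (by positivity), neg_neg, Real.rpow_add (by positivity), Real.rpow_one,
        Real.rpow_mul hR.le, mul_comm lam q, Real.rpow_neg hRa.le]
      have := Real.rpow_pos_of_pos hRa (1 + q * lam)
      field_simp
    rw [hprod, Real.mul_rpow (by positivity) (by positivity), ← Real.rpow_mul (by positivity),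
      mul_assoc, mul_one_div_cancel hq0.ne', mul_one, Real.inv_rpow hb.le, Real.rpow_neg hb.le]
  have : Nonempty {R : ℝ // 0 < R} := ⟨⟨1, one_pos⟩⟩
  exact (iSup_congr hterm).trans iSup_const
end
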